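/- arXiv:1611.02371 — 3 statements merged into one kernel-verified Lean document; each statement's English description precedes it below -/
import Mathlib

section
/- Let 𝒳 be a hypersurface of degree ≥ 2 in ℙ^m over an algebraically closed field, and let ℒ be a linear subspace of ℙ^m contained in 𝒳. If 𝒳 is nonsingular, then dim ℒ ≤ ⌊(m−1)/2⌋. -/
open MvPolynomial

namespace MvPolynomial

/-- Directional derivative as the derivative of the restriction to a line. -/
theorem derivative_aeval_line {R σ : Type*} [CommRing R] [Fintype σ] (v w : σ → R)
    (F : MvPolynomial σ R) :
    Polynomial.derivative
        (aeval (fun i => Polynomial.C (v i) + Polynomial.C (w i) * Polynomial.X) F) =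
      ∑ i, Polynomial.C (w i) *
        aeval (fun i => Polynomial.C (v i) + Polynomial.C (w i) * Polynomial.X) (pderiv i F) := by
  classical
  induction F using MvPolynomial.induction_on with
  | C a => simp
  | add p q hp hq => simp [hp, hq, mul_add, Finset.sum_add_distrib]
  | mul_X p j hp =>
    simp only [map_mul, aeval_X, Polynomial.derivative_mul, hp, Derivation.leibniz, smul_eq_mul,
      map_add, mul_add, Finset.sum_add_distrib, pderiv_X, Finset.sum_mul]
    have hsingle : ∑ i, Polynomial.C (w i) * (aeval (fun i => Polynomial.C (v i) +
        Polynomial.C (w i) * Polynomial.X) p * aeval (fun i => Polynomial.C (v i) +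
        Polynomial.C (w i) * Polynomial.X) (Pi.single (M := fun _ => MvPolynomial σ R) i 1 j)) =
        Polynomial.C (w j) * aeval (fun i => Polynomial.C (v i) +
          Polynomial.C (w i) * Polynomial.X) p := by
      rw [Finset.sum_eq_single j (fun i _ hi => by simp [hi.symm]) (by simp)]
      simp
    rw [hsingle, add_comm]
    simp only [Polynomial.derivative_C, Polynomial.derivative_X, zero_mul, zero_add, mul_one,
      add_zero, mul_zero, add_mul, mul_add, Finset.sum_add_distrib]
    simp only [mul_comm, mul_left_comm, mul_assoc]
    abel

/-- If `F` vanishes on a line through `v` in direction `w`, then so does its derivative at `v`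
in direction `w`. -/
theorem sum_mul_eval_pderiv_eq_zero {K σ : Type*} [Field K] [Infinite K] [Fintype σ]
    {F : MvPolynomial σ K} {v w : σ → K} (h : ∀ t : K, eval (v + t • w) F = 0) :
    ∑ i, w i * eval v (pderiv i F) = 0 := by
  have heval (t : K) (G : MvPolynomial σ K) : Polynomial.eval t
      (aeval (fun i => Polynomial.C (v i) + Polynomial.C (w i) * Polynomial.X) G) =
      eval (v + t • w) G := by
    rw [← Polynomial.coe_aeval_eq_eval, comp_aeval_apply, ← coe_aeval_eq_eval]
    refine congrArg (fun u => aeval u _) ?_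
    ext i
    simp only [Polynomial.coe_aeval_eq_eval, Polynomial.eval_add, Polynomial.eval_mul,
      Polynomial.eval_C, Polynomial.eval_X, Pi.add_apply, Pi.smul_apply, smul_eq_mul, mul_comm]
  have hq : aeval (fun i => Polynomial.C (v i) + Polynomial.C (w i) * Polynomial.X) F = 0 :=
    Polynomial.funext fun t => by rw [heval, h, Polynomial.eval_zero]
  have hd := congrArg (Polynomial.eval 0) (derivative_aeval_line v w F)
  simpa [hq, Polynomial.eval_finsetSum, heval] using hd.symm

/-- Translation by `c` as an automorphism of the polynomial ring. -/
noncomputable def translateEquiv {R σ : Type*} [CommRing R] (c : σ → R) :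
    MvPolynomial σ R ≃ₐ[R] MvPolynomial σ R :=
  AlgEquiv.ofAlgHom (aeval fun i => X i + C (c i)) (aeval fun i => X i - C (c i))
    (by ext i; simp [← algebraMap_eq]) (by ext i; simp [← algebraMap_eq])

theorem aeval_translateEquiv {R σ : Type*} [CommRing R] (c x : σ → R) (p : MvPolynomial σ R) :
    aeval x (translateEquiv c p) = aeval (x + c) p := by
  have : (aeval x).comp (translateEquiv c).toAlgHom = aeval (R := R) (x + c) := by
    ext i; simp [translateEquiv]
  exact DFunLike.congr_fun this p

theorem height_vanishingIdeal_singleton {K σ : Type*} [Field K] [IsAlgClosed K] [Finite σ]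
    (x : σ → K) : (vanishingIdeal K {x}).height = Nat.card σ := by
  have hdim : ringKrullDim (MvPolynomial σ K) = Nat.card σ := by
    rw [ringKrullDim_of_isNoetherianRing, ringKrullDim_eq_zero_of_field, zero_add]
  have : FiniteRingKrullDim (MvPolynomial σ K) := by
    rw [finiteRingKrullDim_iff_ne_bot_and_top, hdim]
    exact ⟨WithBot.coe_ne_bot, WithBot.coe_injective.ne (ENat.natCast_ne_top _)⟩
  obtain ⟨M, hM, hMh⟩ := Ideal.exists_isMaximal_height (R := MvPolynomial σ K)
  obtain ⟨y, rfl⟩ := isMaximal_iff_eq_vanishingIdeal_singleton.1 hM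
  have hcomap : (vanishingIdeal K {y}).comap (translateEquiv (x - y)).toRingEquiv =
      vanishingIdeal K {x} := by
    ext p
    rw [Ideal.mem_comap, mem_vanishingIdeal_singleton_iff, mem_vanishingIdeal_singleton_iff]
    change aeval y (translateEquiv (x - y) p) = 0 ↔ _
    rw [aeval_translateEquiv, add_sub_cancel]
  rw [← hcomap, RingEquiv.height_comap]
  rw [hdim] at hMh
  exact_mod_cast hMh

/-- Fewer polynomials than variables, all vanishing at `x`, have another common zero. -/
theorem exists_ne_common_zero {K σ ι : Type*} [Field K] [IsAlgClosed K] [Finite σ] [Finite ι]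
    (hcard : Nat.card ι < Nat.card σ) (g : ι → MvPolynomial σ K) (x : σ → K)
    (hg : ∀ j, eval x (g j) = 0) : ∃ y, y ≠ x ∧ ∀ j, eval y (g j) = 0 := by
  by_contra! hcon
  have hmin : vanishingIdeal K {x} ∈ (Ideal.span (Set.range g)).minimalPrimes := by
    refine ⟨⟨inferInstance, Ideal.span_le.2 ?_⟩, fun P ⟨hP, hle⟩ _ => ?_⟩
    · rintro _ ⟨j, rfl⟩
      simpa [mem_vanishingIdeal_singleton_iff, aeval_eq_eval] using hg j
    · rw [← IsPrime.vanishingIdeal_zeroLocus (K := K) P]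
      refine vanishingIdeal_anti_mono fun y hy => ?_
      by_contra hyx
      obtain ⟨j, hj⟩ := hcon y hyx
      exact hj (by simpa [aeval_eq_eval] using hy _ (hle (Ideal.subset_span ⟨j, rfl⟩)))
  have h := Ideal.height_le_card_of_mem_minimalPrimes_span (Set.finite_range g) hmin
  rw [height_vanishingIdeal_singleton, Nat.cast_le, ← _root_.Nat.card_coe_set_eq] at h
  exact absurd (h.trans (Finite.card_range_le g)) hcard.not_ge

end MvPolynomial

/-- Let `𝒳 = {F = 0}` be a hypersurface of degree `d ≥ 2` in `ℙ^m` over an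
algebraically closed field `K`, and let `ℒ` (the projectivization of the `(r+1)`-dimensional
linear subspace `W` of `K^{m+1}`) be a linear subspace of `ℙ^m` contained in `𝒳`.
If `𝒳` is nonsingular, then `dim ℒ = r ≤ ⌊(m−1)/2⌋`. -/
theorem stmt3 {K : Type*} [Field K] [IsAlgClosed K] (m d : ℕ) (hd : 2 ≤ d)
    (F : MvPolynomial (Fin (m + 1)) K) (hF : F ≠ 0) (hFhom : F.IsHomogeneous d)
    (hns : ∀ a : Fin (m + 1) → K, a ≠ 0 →
      ¬ (eval a F = 0 ∧ ∀ i, eval a (pderiv i F) = 0))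
    (W : Submodule K (Fin (m + 1) → K)) (r : ℕ) (hW : Module.finrank K W = r + 1)
    (hWX : ∀ v ∈ W, eval v F = 0) :
    r ≤ (m - 1) / 2 := by
  have hfin : Module.finrank K (Fin (m + 1) → K) = m + 1 := Module.finrank_fin_fun K
  obtain ⟨W', hWW'⟩ := W.exists_isCompl
  have hsum := Submodule.finrank_add_eq_of_isCompl hWW'
  by_contra! hr
  let b := Module.finBasis K W
  let c := Module.finBasis K W'
  let φ : (Fin (Module.finrank K W) → K) → Fin (m + 1) → K :=
    fun x => ((∑ l, x l • b l : W) : Fin (m + 1) → K)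
  let g : Fin (Module.finrank K W') → MvPolynomial (Fin (Module.finrank K W)) K := fun j =>
    ∑ i, C ((c j : Fin (m + 1) → K) i) *
      aeval (fun i => ∑ l, C ((b l : Fin (m + 1) → K) i) * X l) (pderiv i F)
  have hg (x) (j) : eval x (g j) =
      ∑ i, (c j : Fin (m + 1) → K) i * eval (φ x) (pderiv i F) := by
    simp only [g, map_sum, map_mul, eval_C]
    refine Finset.sum_congr rfl fun i _ => congrArg _ ?_
    rw [← coe_aeval_eq_eval, RingHom.coe_coe, comp_aeval_apply, ← coe_aeval_eq_eval]
    refine congrArg (fun u => aeval u _) (funext fun _ => ?_)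
    simp [φ, mul_comm]
  have hd0 (i) : eval 0 (pderiv i F) = 0 := by
    rw [eval_zero, constantCoeff_eq]
    exact (hFhom.pderiv (i := i)).coeff_eq_zero (by simp; omega)
  have hφ0 : φ 0 = 0 := by simp [φ]
  obtain ⟨y, hy0, hy⟩ := exists_ne_common_zero (by simp; omega) g 0
    (fun j => by simp only [hg, hφ0, hd0, mul_zero, Finset.sum_const_zero])
  have hφW : φ y ∈ W := Submodule.coe_mem _
  have hφ : φ y ≠ 0 := fun h => hy0 <| funext <|
    Fintype.linearIndependent_iff.1 b.linearIndependent y (Subtype.ext h)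
  refine hns _ hφ ⟨hWX _ hφW, fun i => ?_⟩
  let grad : (Fin (m + 1) → K) →ₗ[K] K :=
    Fintype.linearCombination K fun i => eval (φ y) (pderiv i F)
  have hgW : W ≤ LinearMap.ker grad := fun w hw => by
    simpa [grad, Fintype.linearCombination_apply] using
      sum_mul_eval_pderiv_eq_zero fun t => hWX _ (W.add_mem hφW (W.smul_mem t hw))
  have hgW' : W' ≤ LinearMap.ker grad := by
    have : grad ∘ₗ W'.subtype = 0 := c.ext fun j => by
      simpa [grad, Fintype.linearCombination_apply, hg] using hy j
    exact fun w hw => LinearMap.congr_fun this (⟨w, hw⟩ : W')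
  have hker : Pi.single i 1 ∈ LinearMap.ker grad :=
    (hWW'.sup_eq_top.ge.trans (sup_le hgW hgW')) Submodule.mem_top
  simpa [grad, Fintype.linearCombination_apply_single] using hker
end

section
/- Let f(X₀,…,X_m) be a homogeneous polynomial over 𝔽_q of degree d with 1 ≤ d ≤ q. If f(a₀,…,a_m) = 0 for every (a₀,…,a_m) ∈ 𝔽_q^{m+1}, then f is the zero polynomial. -/
open MvPolynomial

/-- Let `f(X₀, …, X_m)` be a homogeneous polynomial over `𝔽_q` of degree `d`
with `1 ≤ d ≤ q`. If `f(a₀, …, a_m) = 0` for every `(a₀, …, a_m) ∈ 𝔽_q^{m+1}`, then `f` is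
the zero polynomial. -/
theorem stmt6 {K : Type*} [Field K] [Fintype K] (q m d : ℕ) (hq : Fintype.card K = q)
    (hd1 : 1 ≤ d) (hdq : d ≤ q)
    (f : MvPolynomial (Fin (m + 1)) K) (hfhom : f.IsHomogeneous d)
    (hvanish : ∀ a : Fin (m + 1) → K, eval a f = 0) :
    f = 0 := by
  refine hfhom.eq_zero_of_forall_eval_eq_zero_of_le_card hvanish ?_
  rw [Cardinal.mk_fintype, hq]
  exact_mod_cast hdq
end

section
/- Let q be a prime power, m and k integers with m ≥ 3 and 1 ≤ k ≤ m−2, and d an integer with 2 ≤ d ≤ q+1. Set S = θ_q(m−k−1)·q^k·(d−1) + θ_q(k) and T = d·q^{m−1} + θ_q(m−2) + (d−(q+1))·Σ_{i=k}^{m−2} q^i·θ_q(m−1)/(θ_q(i)·θ_q(i+1)) (a rational number). Then S ≤ T, and if moreover d ≤ q then S < T. -/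
/-- `theta q m = θ_q(m) = 1 + q + ⋯ + q^m`. -/
def theta (q m : ℕ) : ℕ := ∑ ν ∈ Finset.range (m + 1), q ^ ν

theorem theta_succ (q a : ℕ) : theta q (a + 1) = theta q a + q ^ (a + 1) :=
  Finset.sum_range_succ _ _

theorem theta_add_add_one (q a b : ℕ) :
    theta q (a + b + 1) = theta q a + q ^ (a + 1) * theta q b := by
  simp only [theta, Finset.mul_sum, ← pow_add]
  rw [show a + b + 1 + 1 = (a + 1) + (b + 1) by ring, Finset.sum_range_add]

theorem theta_pos (q a : ℕ) : 0 < theta q a := by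
  simp [theta, Finset.sum_range_succ']

theorem one_lt_theta {q a : ℕ} (hq : 0 < q) (ha : 1 ≤ a) : 1 < theta q a := by
  obtain ⟨b, rfl⟩ := Nat.exists_eq_add_of_le' ha
  rw [theta_succ]
  have := theta_pos q b
  have := pow_pos hq (b + 1)
  omega

/-- Closed form of a telescoping sum. -/
theorem sum_Icc_pow_mul_div_theta (q k n : ℕ) (c : ℚ) :
    ∑ i ∈ Finset.Icc k (k + n), (q : ℚ) ^ i * c / ((theta q i : ℚ) * (theta q (i + 1) : ℚ)) =
      (q : ℚ) ^ k * theta q n * c / (theta q k * theta q (k + n + 1)) := by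
  induction n with
  | zero => simp [theta]
  | succ n ih =>
    rw [← add_assoc, Finset.sum_Icc_succ_top (by omega), ih]
    have h₀ : (theta q k : ℚ) ≠ 0 := by exact_mod_cast (theta_pos q k).ne'
    have h₁ : (theta q (k + n + 1) : ℚ) ≠ 0 := by exact_mod_cast (theta_pos q _).ne'
    have h₂ : (theta q (k + n + 1 + 1) : ℚ) ≠ 0 := by exact_mod_cast (theta_pos q _).ne'
    have e₁ : (theta q (k + n + 1) : ℚ) = theta q k + q ^ (k + 1) * theta q n := by
      exact_mod_cast theta_add_add_one q k n
    have e₂ : (theta q (k + n + 1 + 1) : ℚ) = theta q (k + n + 1) + q ^ (k + n + 1 + 1) := by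
      exact_mod_cast theta_succ q (k + n + 1)
    have e₃ : (theta q (n + 1) : ℚ) = theta q n + q ^ (n + 1) := by
      exact_mod_cast theta_succ q n
    rw [div_add_div _ _ (mul_ne_zero h₀ h₁) (mul_ne_zero h₁ h₂),
      div_eq_div_iff (by positivity) (by positivity), e₂, e₃, e₁]
    ring

/-- Let `q` be a prime power, `m, k` integers with `m ≥ 3` and
`1 ≤ k ≤ m − 2`, and `d` an integer with `2 ≤ d ≤ q + 1`. Set
`S = θ_q(m−k−1)·q^k·(d−1) + θ_q(k)` and
`T = d·q^{m−1} + θ_q(m−2) + (d−(q+1))·∑_{i=k}^{m−2} q^i·θ_q(m−1)/(θ_q(i)·θ_q(i+1))` (a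
rational number). Then `S ≤ T`, and if moreover `d ≤ q` then `S < T`. -/
theorem stmt19 (q m k d : ℕ) (hq : IsPrimePow q) (hm : 3 ≤ m)
    (hk1 : 1 ≤ k) (hk2 : k ≤ m - 2) (hd2 : 2 ≤ d) (hdq : d ≤ q + 1) :
    ((theta q (m - k - 1) * q ^ k * (d - 1) + theta q k : ℕ) : ℚ) ≤
      (d : ℚ) * (q : ℚ) ^ (m - 1) + (theta q (m - 2) : ℚ) +
        ((d : ℚ) - ((q : ℚ) + 1)) *
          ∑ i ∈ Finset.Icc k (m - 2),
            (q : ℚ) ^ i * (theta q (m - 1) : ℚ) / ((theta q i : ℚ) * (theta q (i + 1) : ℚ)) ∧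
    (d ≤ q →
      ((theta q (m - k - 1) * q ^ k * (d - 1) + theta q k : ℕ) : ℚ) <
        (d : ℚ) * (q : ℚ) ^ (m - 1) + (theta q (m - 2) : ℚ) +
          ((d : ℚ) - ((q : ℚ) + 1)) *
            ∑ i ∈ Finset.Icc k (m - 2),
              (q : ℚ) ^ i * (theta q (m - 1) : ℚ) /
                ((theta q i : ℚ) * (theta q (i + 1) : ℚ))) := by
  obtain ⟨n, rfl⟩ : ∃ n, m = k + n + 2 := ⟨m - k - 2, by omega⟩
  obtain ⟨c, rfl⟩ : ∃ c, d = c + 1 := ⟨d - 1, by omega⟩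
  have hθ : 1 < (theta q k : ℚ) := by exact_mod_cast one_lt_theta hq.pos hk1
  have hq₀ : 0 < (q : ℚ) := by exact_mod_cast hq.pos
  have hn : 0 < (theta q n : ℚ) := by exact_mod_cast theta_pos q n
  have h₁ : (theta q (k + n + 1) : ℚ) ≠ 0 := by exact_mod_cast (theta_pos q _).ne'
  have e₁ : (theta q (k + n + 1) : ℚ) = theta q k + q ^ (k + 1) * theta q n := by
    exact_mod_cast theta_add_add_one q k n
  have e₂ : (theta q (k + n + 1) : ℚ) = theta q (k + n) + q ^ (k + n + 1) := by
    exact_mod_cast theta_succ q (k + n)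
  have e₃ : (theta q (n + 1) : ℚ) = theta q n + q ^ (n + 1) := by
    exact_mod_cast theta_succ q n
  rw [show k + n + 2 - k - 1 = n + 1 by omega, show k + n + 2 - 1 = k + n + 1 by omega,
    show k + n + 2 - 2 = k + n by omega, Nat.add_sub_cancel, sum_Icc_pow_mul_div_theta,
    mul_div_mul_right _ _ h₁]
  push_cast
  rw [e₃]
  have hgap : ((c : ℚ) + 1) * q ^ (k + n + 1) + theta q (k + n) +
      ((c : ℚ) + 1 - (q + 1)) * (q ^ k * theta q n / theta q k) -
      ((theta q n + q ^ (n + 1)) * q ^ k * c + theta q k) =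
      ((q : ℚ) - c) * (q ^ k * theta q n * (1 - 1 / theta q k)) := by
    linear_combination e₁ - e₂
  have hpos : 0 < (q : ℚ) ^ k * theta q n * (1 - 1 / theta q k) :=
    mul_pos (by positivity) (sub_pos.2 ((div_lt_one (by positivity)).2 hθ))
  refine ⟨?_, fun hd ↦ ?_⟩
  · have hc : (c : ℚ) ≤ q := by exact_mod_cast Nat.le_of_succ_le_succ hdq
    exact sub_nonneg.1 (hgap ▸ mul_nonneg (sub_nonneg.2 hc) hpos.le)
  · have hc : (c : ℚ) < q := by exact_mod_cast hd
    exact sub_pos.1 (hgap ▸ mul_pos (sub_pos.2 hc) hpos)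
end
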